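/- Let Ω be a domain (possibly unbounded) in ℝ^N, N ≥ 1. Let V ∈ L¹_loc(Ω) with V > 0 almost everywhere in Ω. Assume u ∈ L¹_loc(Ω) with Vu ∈ L¹_loc(Ω) is nonnegative, not almost everywhere zero, and satisfies −Δu ≥ Vu in the sense of distributions on Ω, i.e. ∫_Ω u(−Δφ) dx ≥ ∫_Ω Vuφ dx for every nonnegative φ ∈ C_c^∞(Ω). Then ∫_Ω|∇φ|² dx ≥ ∫_Ω Vφ² dx for every φ ∈ C_c^∞(Ω). -/

import Mathlib

open MeasureTheory Metric Filter
open scoped Topology ENNReal NNReal RealInnerProductSpace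

noncomputable section

/-- `ℝ^N` as a Euclidean space. -/
abbrev Euc (N : ℕ) : Type := EuclideanSpace ℝ (Fin N)

/-- `φ ∈ C_c^∞(Ω)`: smooth functions with compact support contained in `Ω`. -/
def IsTestFun {N : ℕ} (Ω : Set (Euc N)) (φ : Euc N → ℝ) : Prop :=
  ContDiff ℝ (⊤ : ℕ∞) φ ∧ HasCompactSupport φ ∧ tsupport φ ⊆ Ω

/-- The classical Laplacian of `φ` at `x`: the sum of the pure second partial derivatives. -/
def lap {N : ℕ} (φ : Euc N → ℝ) (x : Euc N) : ℝ :=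
  ∑ i : Fin N, iteratedFDeriv ℝ 2 φ x ![EuclideanSpace.single i 1, EuclideanSpace.single i 1]

theorem lap_eq {N : ℕ} {φ : Euc N → ℝ} (h : ContDiff ℝ (⊤ : ℕ∞) φ) (x : Euc N) :
    lap φ x = ∑ i : Fin N, fderiv ℝ (fun y => fderiv ℝ φ y (EuclideanSpace.single i 1)) x
      (EuclideanSpace.single i 1) := by
  unfold lap
  refine Finset.sum_congr rfl fun i _ => ?_
  have hd : DifferentiableAt ℝ (fderiv ℝ φ) x :=
    ((h.fderiv_right (m := (⊤ : ℕ∞)) (by simp)).differentiable (by simp)) x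
  rw [iteratedFDeriv_two_apply, fderiv_clm_apply hd (differentiableAt_const _)]
  simp

theorem contDiff_pd {N : ℕ} {φ : Euc N → ℝ} (h : ContDiff ℝ (⊤ : ℕ∞) φ) (v : Euc N) :
    ContDiff ℝ (⊤ : ℕ∞) (fun y => fderiv ℝ φ y v) :=
  (h.fderiv_right (m := (⊤ : ℕ∞)) (by simp)).clm_apply contDiff_const

theorem norm_grad_sq {N : ℕ} {φ : Euc N → ℝ} (x : Euc N) :
    ‖gradient φ x‖ ^ 2 = ∑ i : Fin N, (fderiv ℝ φ x (EuclideanSpace.single i 1)) ^ 2 := by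
  rw [EuclideanSpace.norm_sq_eq]
  refine Finset.sum_congr rfl fun i _ => ?_
  have : fderiv ℝ φ x (EuclideanSpace.single i 1)
      = inner ℝ (gradient φ x) (EuclideanSpace.single i 1) := by
    unfold gradient
    rw [InnerProductSpace.toDual_symm_apply]
  rw [this, EuclideanSpace.inner_single_right]
  simp

theorem picone {N : ℕ} {w φ : Euc N → ℝ} (hw : ContDiff ℝ (⊤ : ℕ∞) w) (hw0 : ∀ x, 0 ≤ w x)
    (hφ : ContDiff ℝ (⊤ : ℕ∞) φ) (hφc : HasCompactSupport φ) {δ : ℝ} (hδ : 0 < δ) :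
    Integrable (fun x => (-(lap w x)) * (φ x ^ 2 / (w x + δ))) ∧
    ∫ x, (-(lap w x)) * (φ x ^ 2 / (w x + δ)) ≤ ∫ x, ‖gradient φ x‖ ^ 2 := by
  have hpos : ∀ x, 0 < w x + δ := fun x => by linarith [hw0 x]
  set ψ : Euc N → ℝ := fun x => φ x ^ 2 / (w x + δ) with hψ
  have hψs : ContDiff ℝ (⊤ : ℕ∞) ψ :=
    (hφ.pow 2).div (hw.add contDiff_const) (fun x => (hpos x).ne')
  have hψc : HasCompactSupport ψ := by
    refine hφc.mono ?_
    intro x hx hx'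
    apply hx
    simp [hψ, hx']
  have key : ∀ i : Fin N,
      Integrable (fun x => fderiv ℝ (fun y => fderiv ℝ w y (EuclideanSpace.single i 1)) x
        (EuclideanSpace.single i 1) * ψ x) ∧
      Integrable (fun x => (fderiv ℝ φ x (EuclideanSpace.single i 1)) ^ 2) ∧
      - ∫ x, fderiv ℝ (fun y => fderiv ℝ w y (EuclideanSpace.single i 1)) x
        (EuclideanSpace.single i 1) * ψ x ≤ ∫ x, (fderiv ℝ φ x (EuclideanSpace.single i 1)) ^ 2 := by
    intro i
    set e : Euc N := EuclideanSpace.single i 1 with he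
    have c1 := contDiff_pd hw e
    have c2 := contDiff_pd c1 e
    have c3 := contDiff_pd hψs e
    have c4 := contDiff_pd hφ e
    have s3 : HasCompactSupport (fun x => fderiv ℝ ψ x e) := hψc.fderiv_apply (𝕜 := ℝ) e
    have s4 : HasCompactSupport (fun x => fderiv ℝ φ x e) := hφc.fderiv_apply (𝕜 := ℝ) e
    have i1 : Integrable (fun x => fderiv ℝ (fun y => fderiv ℝ w y e) x e * ψ x) :=
      (c2.continuous.mul hψs.continuous).integrable_of_hasCompactSupport hψc.mul_left
    have i2 : Integrable (fun x => fderiv ℝ w x e * fderiv ℝ ψ x e) :=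
      (c1.continuous.mul c3.continuous).integrable_of_hasCompactSupport s3.mul_left
    have i3 : Integrable (fun x => fderiv ℝ w x e * ψ x) :=
      (c1.continuous.mul hψs.continuous).integrable_of_hasCompactSupport hψc.mul_left
    have i4 : Integrable (fun x => (fderiv ℝ φ x e) ^ 2) := by
      simp_rw [pow_two]
      exact (c4.continuous.mul c4.continuous).integrable_of_hasCompactSupport s4.mul_left
    refine ⟨i1, i4, ?_⟩
    have ibp := integral_mul_fderiv_eq_neg_fderiv_mul_of_integrable (μ := volume) i1 i2 i3
      (fun x _ => (c1.differentiable (by simp)) x) (fun x _ => (hψs.differentiable (by simp)) x)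
    rw [← ibp]
    refine integral_mono i2 i4 fun x => ?_
    have hwd : HasFDerivAt (fun y => w y + δ) (fderiv ℝ w x) x :=
      ((hw.differentiable (by simp)) x).hasFDerivAt.add_const δ
    have hφd : HasFDerivAt φ (fderiv ℝ φ x) x := ((hφ.differentiable (by simp)) x).hasFDerivAt
    have hdiv := (hφd.pow 2).mul ((hasDerivAt_inv (hpos x).ne').comp_hasFDerivAt x hwd)
    have hψ' : fderiv ℝ ψ x e = 2 * φ x * fderiv ℝ φ x e / (w x + δ)
        - φ x ^ 2 * fderiv ℝ w x e / (w x + δ) ^ 2 := by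
      have : ψ = ((fun x => φ x ^ 2) * (Inv.inv ∘ fun y => w y + δ)) := by
        ext y; simp [hψ, div_eq_mul_inv]
      rw [this, HasFDerivAt.fderiv hdiv]
      simp
      ring
    simp only [hψ']
    have : fderiv ℝ w x e * (2 * φ x * fderiv ℝ φ x e / (w x + δ)
        - φ x ^ 2 * fderiv ℝ w x e / (w x + δ) ^ 2)
        = (fderiv ℝ φ x e)^2 - (fderiv ℝ φ x e - φ x * fderiv ℝ w x e / (w x + δ)) ^ 2 := by
      have := (hpos x).ne'
      field_simp
      ring
    rw [this]
    nlinarith [sq_nonneg (fderiv ℝ φ x e - φ x * fderiv ℝ w x e / (w x + δ))]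
  have e1 : (fun x => (-(lap w x)) * ψ x) = fun x => - ∑ i : Fin N,
      fderiv ℝ (fun y => fderiv ℝ w y (EuclideanSpace.single i 1)) x
        (EuclideanSpace.single i 1) * ψ x := by
    ext x
    rw [lap_eq hw, neg_mul, Finset.sum_mul]
  rw [e1]
  refine ⟨(integrable_finsetSum _ fun i _ => (key i).1).neg, ?_⟩
  simp_rw [norm_grad_sq]
  rw [integral_neg, integral_finsetSum _ (fun i _ => (key i).1),
    integral_finsetSum _ (fun i _ => (key i).2.1), ← Finset.sum_neg_distrib]
  exact Finset.sum_le_sum fun i _ => (key i).2.2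

theorem moll_smooth {N : ℕ} {g η : Euc N → ℝ} (hg : LocallyIntegrable g volume)
    (hη : ContDiff ℝ (⊤ : ℕ∞) η) (hηc : HasCompactSupport η) :
    ContDiff ℝ (⊤ : ℕ∞) (fun x => ∫ y, g y * η (x - y)) :=
  hηc.contDiff_convolution_right (ContinuousLinearMap.mul ℝ ℝ) hg hη

theorem moll_fderiv {N : ℕ} {g η : Euc N → ℝ} (hg : LocallyIntegrable g volume)
    (hη : ContDiff ℝ (⊤ : ℕ∞) η) (hηc : HasCompactSupport η) (v x : Euc N) :
    fderiv ℝ (fun x => ∫ y, g y * η (x - y)) x v = ∫ y, g y * fderiv ℝ η (x - y) v := by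
  have := hηc.hasFDerivAt_convolution_right (ContinuousLinearMap.mul ℝ ℝ) hg
    (hη.of_le (by exact_mod_cast le_top)) x
  have h2 := this.fderiv
  have h3 := convolution_precompR_apply (ContinuousLinearMap.mul ℝ ℝ) (μ := volume) hg
    (hηc.fderiv ℝ) (hη.continuous_fderiv (by simp)) x v
  rw [← h2] at h3
  exact h3

theorem moll_lap {N : ℕ} {g η : Euc N → ℝ} (hg : LocallyIntegrable g volume)
    (hη : ContDiff ℝ (⊤ : ℕ∞) η) (hηc : HasCompactSupport η) (x : Euc N) :
    lap (fun x => ∫ y, g y * η (x - y)) x = ∫ y, g y * lap η (x - y) := by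
  rw [lap_eq (moll_smooth hg hη hηc)]
  simp_rw [lap_eq hη, Finset.mul_sum]
  rw [integral_finsetSum]
  · refine Finset.sum_congr rfl fun i _ => ?_
    simp_rw [moll_fderiv hg hη hηc]
    exact moll_fderiv hg (contDiff_pd hη _) (hηc.fderiv_apply (𝕜 := ℝ) _) _ _
  · intro i _
    have := ((hηc.fderiv_apply (𝕜 := ℝ) (EuclideanSpace.single i 1)).fderiv_apply (𝕜 := ℝ)
      (EuclideanSpace.single i 1)).convolutionExists_right (ContinuousLinearMap.mul ℝ ℝ) hg
      (contDiff_pd (contDiff_pd hη _) _).continuous x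
    exact this

theorem lap_reflect {N : ℕ} {η : Euc N → ℝ} (hη : ContDiff ℝ (⊤ : ℕ∞) η) (x y : Euc N) :
    lap (fun y => η (x - y)) y = lap η (x - y) := by
  have hη' : ContDiff ℝ (⊤ : ℕ∞) (fun y => η (x - y)) := hη.comp (contDiff_const.sub contDiff_id)
  rw [lap_eq hη', lap_eq hη]
  refine Finset.sum_congr rfl fun i _ => ?_
  have gen : ∀ f : Euc N → ℝ, ContDiff ℝ (⊤ : ℕ∞) f → ∀ v z : Euc N,
      fderiv ℝ (fun y => f (x - y)) z v = - fderiv ℝ f (x - z) v := by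
    intro f hf v z
    have h1 : HasFDerivAt f (fderiv ℝ f (x - z)) (x - z) :=
      (hf.differentiable (by simp) _).hasFDerivAt
    have h2 : HasFDerivAt (fun y : Euc N => x - y) (-(ContinuousLinearMap.id ℝ (Euc N))) z :=
      (hasFDerivAt_id z).const_sub x
    have h3 : HasFDerivAt (fun y => f (x - y)) _ z := h1.comp z h2
    rw [h3.fderiv]
    simp
  simp_rw [gen η hη]
  rw [fderiv_fun_neg]
  simp only [_root_.neg_apply]
  rw [gen _ (contDiff_pd hη _)]
  simp

theorem lap_zero_of_notMem {N : ℕ} {φ : Euc N → ℝ} {y : Euc N} (h : y ∉ tsupport φ) :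
    lap φ y = 0 := by
  have h2 : iteratedFDeriv ℝ 2 φ y = 0 := by
    by_contra h3
    exact h (support_iteratedFDeriv_subset (𝕜 := ℝ) 2 h3)
  simp [lap, h2]

theorem moll_super {N : ℕ} {Ω K : Set (Euc N)} (hK : IsCompact K) (hKΩ : K ⊆ Ω)
    (hΩo : IsOpen Ω) {V u : Euc N → ℝ}
    (huloc : LocallyIntegrableOn u Ω volume)
    (hsuper : ∀ φ : Euc N → ℝ, IsTestFun Ω φ → (∀ x, 0 ≤ φ x) →
      ∫ x in Ω, V x * u x * φ x ≤ ∫ x in Ω, u x * (-(lap φ x)))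
    {η : Euc N → ℝ} (hη : ContDiff ℝ (⊤ : ℕ∞) η) (hη0 : ∀ x, 0 ≤ η x) {ε : ℝ}
    (hηs : tsupport η ⊆ closedBall 0 ε) {x : Euc N} (hx : closedBall x ε ⊆ K) :
    ∫ y, K.indicator (fun y => V y * u y) y * η (x - y) ≤
      -(lap (fun x => ∫ y, K.indicator u y * η (x - y)) x) := by
  have hηc : HasCompactSupport η := (isCompact_closedBall (0 : Euc N) ε).of_isClosed_subset
    (isClosed_tsupport _) hηs
  have hg : LocallyIntegrable (K.indicator u) volume := by
    apply Integrable.locallyIntegrable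
    rw [integrable_indicator_iff hK.measurableSet]
    exact huloc.integrableOn_compact_subset hKΩ hK
  rw [moll_lap hg hη hηc]
  have hs : tsupport (fun y => η (x - y)) ⊆ closedBall x ε := by
    apply closure_minimal _ isClosed_closedBall
    intro y hy
    have : x - y ∈ tsupport η := subset_tsupport _ hy
    have := hηs this
    rw [mem_closedBall, dist_eq_norm] at this ⊢
    rw [norm_sub_rev]; simpa using this
  have ht : IsTestFun Ω (fun y => η (x - y)) :=
    ⟨hη.comp (contDiff_const.sub contDiff_id),
      (isCompact_closedBall x ε).of_isClosed_subset (isClosed_tsupport _) hs,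
      hs.trans (hx.trans hKΩ)⟩
  have h := hsuper _ ht (fun y => hη0 _)
  rw [← integral_indicator hΩo.measurableSet, ← integral_indicator hΩo.measurableSet] at h
  have e1 : (Ω.indicator fun y => V y * u y * η (x - y)) =
      fun y => K.indicator (fun y => V y * u y) y * η (x - y) := by
    ext y
    by_cases hy : y ∈ K
    · simp [hy, hKΩ hy]
    · have : η (x - y) = 0 := by
        by_contra h0
        exact hy (hx (hs (subset_tsupport _ h0)))
      simp [hy, Set.indicator, this]
  have e2 : (Ω.indicator fun y => u y * (-(lap (fun y => η (x - y)) y))) =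
      fun y => -(K.indicator u y * lap η (x - y)) := by
    ext y
    rw [← lap_reflect hη]
    by_cases hy : y ∈ K
    · simp [hy, hKΩ hy]
    · have : lap (fun y => η (x - y)) y = 0 := lap_zero_of_notMem fun h0 => hy (hx (hs h0))
      simp [hy, Set.indicator, this]
  rw [e1, e2, integral_neg] at h
  exact h

/-- Radial profile. -/
def prof (s : ℝ) : ℝ := ((1 - s)⁻¹) ^ 2 * expNegInvGlue (1 - s)

theorem prof_contDiff : ContDiff ℝ (⊤ : ℕ∞) prof := by
  have := (expNegInvGlue.contDiff_polynomial_eval_inv_mul (n := ⊤) (Polynomial.X ^ 2)).comp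
    ((contDiff_const (c := (1 : ℝ))).sub contDiff_id)
  have e : prof = ((fun x => Polynomial.eval x⁻¹ (Polynomial.X ^ 2 : Polynomial ℝ)
      * expNegInvGlue x) ∘ fun x => 1 - id x) := by
    ext s
    simp [prof]
  rw [e]
  exact this

theorem prof_nonneg (s : ℝ) : 0 ≤ prof s :=
  mul_nonneg (sq_nonneg _) (expNegInvGlue.nonneg _)

theorem prof_pos {s : ℝ} (hs : s < 1) : 0 < prof s :=
  mul_pos (pow_pos (inv_pos.2 (by linarith)) 2) (expNegInvGlue.pos_of_pos (by linarith))

theorem prof_zero {s : ℝ} (hs : 1 ≤ s) : prof s = 0 := by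
  simp [prof, expNegInvGlue.zero_of_nonpos (show 1 - s ≤ 0 by linarith)]

theorem hasDerivAt_glue (s : ℝ) : HasDerivAt (fun s => expNegInvGlue (1 - s)) (-(prof s)) s := by
  have h := expNegInvGlue.hasDerivAt_polynomial_eval_inv_mul 1 (1 - s)
  have h2 := h.comp s ((hasDerivAt_id s).const_sub 1)
  have e : ((fun x => Polynomial.eval x⁻¹ (1 : Polynomial ℝ) * expNegInvGlue x) ∘ fun x => 1 - id x)
      = fun s => expNegInvGlue (1 - s) := by
    ext; simp
  have h3 : HasDerivAt (fun s => expNegInvGlue (1 - s)) _ s := e ▸ h2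
  refine h3.congr_deriv ?_
  simp [prof]

theorem hasDerivAt_prof (s : ℝ) : HasDerivAt prof (deriv prof s) s :=
  (prof_contDiff.differentiable (by simp) s).hasDerivAt

theorem scal_deriv (n : ℕ) (q : ℝ) {t : ℝ} (ht : 0 < t) :
    HasDerivAt (fun t => (t ^ n)⁻¹ * prof (q / t ^ 2))
      (t * (t ^ n)⁻¹ * (-(2 * q * deriv prof (q / t ^ 2) / t ^ 4 + n * prof (q / t ^ 2) / t ^ 2))) t := by
  have h1 : HasDerivAt (fun t : ℝ => (t ^ n)⁻¹) _ t := (hasDerivAt_pow n t).fun_inv (by positivity)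
  have h2 : HasDerivAt (fun t : ℝ => q / t ^ 2) _ t :=
    (hasDerivAt_const t q).fun_div (hasDerivAt_pow 2 t) (by positivity)
  have h3 := h1.fun_mul ((hasDerivAt_prof (q / t ^ 2)).comp t h2)
  refine h3.congr_deriv ?_
  simp only [Function.comp]
  cases n with
  | zero => simp; field_simp
  | succ n => 
    simp only [Nat.add_sub_cancel]
    push_cast
    field_simp
    ring

/-- Radial test function. -/
def radH {N : ℕ} (z : Euc N) (t : ℝ) (y : Euc N) : ℝ := 2⁻¹ * expNegInvGlue (1 - ‖y - z‖ ^ 2 / t ^ 2)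

theorem radH_contDiff {N : ℕ} (z : Euc N) (t : ℝ) : ContDiff ℝ (⊤ : ℕ∞) (radH z t) := by
  unfold radH
  refine contDiff_const.mul (expNegInvGlue.contDiff.comp (contDiff_const.sub ?_))
  exact ((contDiff_id.sub contDiff_const).norm_sq ℝ).div_const _

theorem radH_nonneg {N : ℕ} (z : Euc N) (t : ℝ) (y) : 0 ≤ radH z t y :=
  mul_nonneg (by norm_num) (expNegInvGlue.nonneg _)

theorem radH_tsupport {N : ℕ} (z : Euc N) {t : ℝ} (ht : 0 < t) :
    tsupport (radH z t) ⊆ closedBall z t := by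
  apply closure_minimal _ isClosed_closedBall
  intro y hy
  by_contra h
  apply hy
  rw [mem_closedBall, dist_eq_norm, not_le] at h
  unfold radH
  rw [expNegInvGlue.zero_of_nonpos, mul_zero]
  rw [sub_nonpos, le_div_iff₀ (by positivity)]
  nlinarith

theorem radH_lap {N : ℕ} (z : Euc N) {t : ℝ} (ht : 0 < t) (y : Euc N) :
    lap (radH z t) y = -(2 * ‖y - z‖ ^ 2 * deriv prof (‖y - z‖ ^ 2 / t ^ 2) / t ^ 4
      + N * prof (‖y - z‖ ^ 2 / t ^ 2) / t ^ 2) := by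
  rw [lap_eq (radH_contDiff z t)]
  have hq : ∀ y, HasFDerivAt (fun y : Euc N => ‖y - z‖ ^ 2 / t ^ 2)
      ((t ^ 2)⁻¹ • (2 • innerSL ℝ (y - z))) y := by
    intro y
    have h1 : HasFDerivAt (fun y : Euc N => y - z) (ContinuousLinearMap.id ℝ (Euc N)) y :=
      (hasFDerivAt_id y).sub_const z
    have h2 := h1.norm_sq
    have h3 := h2.const_mul ((t ^ 2)⁻¹)
    simp only [ContinuousLinearMap.comp_id] at h3
    simpa [div_eq_inv_mul] using h3
  have hi : ∀ (y : Euc N) (i : Fin N), innerSL ℝ (y - z) (EuclideanSpace.single i 1) = (y - z) i := by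
    intro y i
    simp [EuclideanSpace.inner_single_right]
  have d1 : ∀ (y : Euc N) (i : Fin N), fderiv ℝ (radH z t) y (EuclideanSpace.single i 1) =
      -((t ^ 2)⁻¹ * (prof (‖y - z‖ ^ 2 / t ^ 2) * (y - z) i)) := by
    intro y i
    have h := ((hasDerivAt_glue (‖y - z‖ ^ 2 / t ^ 2)).comp_hasFDerivAt y (hq y)).const_mul (2⁻¹ : ℝ)
    have h' : HasFDerivAt (radH z t) _ y := h
    rw [h'.fderiv]
    simp only [_root_.smul_apply, hi, smul_eq_mul, nsmul_eq_mul]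
    push_cast
    ring
  have d2 : ∀ i : Fin N, fderiv ℝ (fun y => fderiv ℝ (radH z t) y (EuclideanSpace.single i 1)) y
      (EuclideanSpace.single i 1) = -(2 * ((y - z) i) ^ 2 * deriv prof (‖y - z‖ ^ 2 / t ^ 2) / t ^ 4
      + prof (‖y - z‖ ^ 2 / t ^ 2) / t ^ 2) := by
    intro i
    simp_rw [d1]
    have hc : HasFDerivAt (fun y : Euc N => (y - z) i) (EuclideanSpace.proj i : Euc N →L[ℝ] ℝ) y := by
      have := (EuclideanSpace.proj i : Euc N →L[ℝ] ℝ).hasFDerivAt.comp y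
        ((hasFDerivAt_id y).sub_const z)
      exact this
    have h := ((((hasDerivAt_prof (‖y - z‖ ^ 2 / t ^ 2)).comp_hasFDerivAt y (hq y)).mul hc).const_mul
      ((t ^ 2)⁻¹)).neg
    have h' : HasFDerivAt (fun y => -((t ^ 2)⁻¹ * (prof (‖y - z‖ ^ 2 / t ^ 2) * (y - z) i))) _ y := h
    rw [h'.fderiv]
    simp only [_root_.neg_apply, _root_.smul_apply, _root_.add_apply, hi, smul_eq_mul, nsmul_eq_mul, Function.comp]
    simp
    field_simp
    ring
  rw [Finset.sum_congr rfl fun i _ => d2 i, EuclideanSpace.norm_sq_eq]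
  simp only [Finset.sum_neg_distrib, Finset.sum_add_distrib, Finset.sum_const, Finset.card_univ,
    Fintype.card_fin, nsmul_eq_mul, Finset.mul_sum, Finset.sum_mul, Finset.sum_div, Real.norm_eq_abs,
    sq_abs]
  ring

theorem zero_near {N : ℕ} {Ω : Set (Euc N)} (hΩo : IsOpen Ω) {V u : Euc N → ℝ}
    (hVpos : ∀ᵐ x ∂volume, x ∈ Ω → 0 < V x)
    (huloc : LocallyIntegrableOn u Ω volume)
    (hu0 : ∀ᵐ x ∂volume, x ∈ Ω → 0 ≤ u x)
    (hsuper : ∀ φ : Euc N → ℝ, IsTestFun Ω φ → (∀ x, 0 ≤ φ x) →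
      ∫ x in Ω, V x * u x * φ x ≤ ∫ x in Ω, u x * (-(lap φ x)))
    {z : Euc N} {R : ℝ} (hR : closedBall z R ⊆ Ω)
    (havg : Tendsto (fun t => ⨍ y in closedBall z t, ‖u y‖) (𝓝[>] (0 : ℝ)) (𝓝 0))
    {b : ℝ} (hb : 0 < b) (hbR : b < R) : ∀ᵐ x ∂volume, x ∈ ball z b → u x = 0 := by
  set B := closedBall z R with hB
  have hBc : IsCompact B := isCompact_closedBall z R
  have huB : IntegrableOn u B := huloc.integrableOn_compact_subset hR hBc
  set k : ℝ → Euc N → ℝ := fun t y => (t ^ N)⁻¹ * prof (‖y - z‖ ^ 2 / t ^ 2) with hk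
  set k' : ℝ → Euc N → ℝ := fun t y => t * (t ^ N)⁻¹ *
    (-(2 * ‖y - z‖ ^ 2 * deriv prof (‖y - z‖ ^ 2 / t ^ 2) / t ^ 4
      + N * prof (‖y - z‖ ^ 2 / t ^ 2) / t ^ 2)) with hk'
  have hpc : Continuous prof := prof_contDiff.continuous
  have hpc' : Continuous (deriv prof) := prof_contDiff.continuous_deriv (by simp)
  have kcont : ∀ t, Continuous (k t) := fun t => by
    simp only [hk]
    fun_prop
  have kcont' : ∀ t, Continuous (k' t) := fun t => by
    simp only [hk']
    fun_prop
  have k0 : ∀ t, 0 < t → ∀ y, 0 ≤ k t y := fun t ht y =>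
    mul_nonneg (by positivity) (prof_nonneg _)
  have hint : ∀ h : Euc N → ℝ, Continuous h → IntegrableOn (fun y => u y * h y) B := by
    intro h hh
    exact huB.mul_continuousOn hh.continuousOn hBc
  set J : ℝ → ℝ := fun t => ∫ y in B, u y * k t y with hJ
  -- derivative
  have hder : ∀ t ∈ Set.Ioo 0 R, HasDerivAt J (∫ y in B, u y * k' t y) t := by
    intro t ht
    have hs : Set.Icc (t / 2) R ∈ 𝓝 t := Icc_mem_nhds (by linarith [ht.1]) ht.2
    have hcont : ContinuousOn (fun p : ℝ × Euc N => k' p.1 p.2) (Set.Icc (t / 2) R ×ˢ B) := by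
      have hne : ∀ p ∈ Set.Icc (t / 2) R ×ˢ B, p.1 ≠ 0 := fun p hp => by
        have := hp.1.1
        have := ht.1
        intro h; linarith
      have c1 : ContinuousOn (fun p : ℝ × Euc N => ‖p.2 - z‖ ^ 2 / p.1 ^ 2)
          (Set.Icc (t / 2) R ×ˢ B) :=
        ContinuousOn.div (by fun_prop) (by fun_prop) (fun p hp => pow_ne_zero _ (hne p hp))
      have c2 := hpc.comp_continuousOn c1
      have c3 := hpc'.comp_continuousOn c1
      refine ContinuousOn.mul (ContinuousOn.mul (by fun_prop) (ContinuousOn.inv₀ (by fun_prop)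
        (fun p hp => pow_ne_zero _ (hne p hp)))) (ContinuousOn.neg (ContinuousOn.add
        (ContinuousOn.div (ContinuousOn.mul (by fun_prop) c3) (by fun_prop)
          (fun p hp => pow_ne_zero _ (hne p hp)))
        (ContinuousOn.div (ContinuousOn.mul (by fun_prop) c2) (by fun_prop)
          (fun p hp => pow_ne_zero _ (hne p hp)))))
    obtain ⟨C, hC⟩ := (isCompact_Icc.prod hBc).exists_bound_of_continuousOn hcont
    refine (hasDerivAt_integral_of_dominated_loc_of_deriv_le (μ := volume.restrict B)
      (F := fun t y => u y * k t y) (F' := fun t y => u y * k' t y)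
      (bound := fun y => ‖u y‖ * C) hs ?_ (hint _ (kcont t)) ?_ ?_ ?_ ?_).2
    · exact Eventually.of_forall fun s => (hint _ (kcont s)).aestronglyMeasurable
    · exact (hint _ (kcont' t)).aestronglyMeasurable
    · refine (ae_restrict_iff' hBc.measurableSet).2 (Eventually.of_forall fun y hy s hs' => ?_)
      rw [norm_mul]
      exact mul_le_mul_of_nonneg_left (hC (s, y) ⟨hs', hy⟩) (norm_nonneg _)
    · exact huB.norm.mul_const C
    · refine Eventually.of_forall fun y s hs' => ?_
      exact (scal_deriv N (‖y - z‖ ^ 2) (t := s) (by linarith [hs'.1, ht.1])).const_mul (u y)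
  have hnonpos : ∀ t ∈ Set.Ioo 0 R, ∫ y in B, u y * k' t y ≤ 0 := by
    intro t ht
    have hts := radH_tsupport z ht.1
    have htB : closedBall z t ⊆ B := closedBall_subset_closedBall ht.2.le
    have hT : IsTestFun Ω (radH z t) := ⟨radH_contDiff z t,
      (isCompact_closedBall z t).of_isClosed_subset (isClosed_tsupport _) hts,
      hts.trans (htB.trans hR)⟩
    have h := hsuper _ hT (radH_nonneg z t)
    have h0 : 0 ≤ ∫ x in Ω, V x * u x * radH z t x := by
      apply integral_nonneg_of_ae
      refine (ae_restrict_iff' hΩo.measurableSet).2 ?_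
      filter_upwards [hVpos, hu0] with x h1 h2 hx
      exact mul_nonneg (mul_nonneg (h1 hx).le (h2 hx)) (radH_nonneg z t x)
    have e : ∫ x in Ω, u x * (-(lap (radH z t) x)) = ∫ x in B, u x * (-(lap (radH z t) x)) := by
      refine setIntegral_eq_of_subset_of_forall_sdiff_eq_zero hΩo.measurableSet hR ?_
      intro x hx
      rw [lap_zero_of_notMem (fun h' => hx.2 (htB (hts h')))]
      simp
    have e2 : ∫ y in B, u y * k' t y
        = -(t * (t ^ N)⁻¹) * ∫ x in B, u x * (-(lap (radH z t) x)) := by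
      rw [← integral_const_mul]
      congr 1
      ext y
      rw [radH_lap z ht.1]
      simp only [hk']
      ring
    rw [e2, ← e]
    have : 0 ≤ t * (t ^ N)⁻¹ := by have := ht.1; positivity
    have := mul_nonneg this (h0.trans h)
    linarith
  have hanti : AntitoneOn J (Set.Ioo 0 R) := by
    apply antitoneOn_of_deriv_nonpos (convex_Ioo 0 R)
    · exact fun t ht => (hder t ht).continuousAt.continuousWithinAt
    · rw [interior_Ioo]
      exact fun t ht => (hder t ht).differentiableAt.differentiableWithinAt
    · rw [interior_Ioo]
      intro t ht
      rw [(hder t ht).deriv]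
      exact hnonpos t ht
  obtain ⟨M, hM⟩ := (isCompact_Icc (a := (0 : ℝ)) (b := 1)).exists_bound_of_continuousOn
    hpc.continuousOn
  set ω := (volume : Measure (Euc N)).real (ball 0 1) with hω
  have hωpos : 0 < ω := by
    rw [hω, measureReal_def]
    exact ENNReal.toReal_pos (measure_ball_pos _ _ one_pos).ne' measure_ball_lt_top.ne
  have hle : ∀ t ∈ Set.Ioo 0 R, J t ≤ M * ω * ⨍ y in closedBall z t, ‖u y‖ := by
    intro t ht
    have ht0 := ht.1
    have htB : closedBall z t ⊆ B := closedBall_subset_closedBall ht.2.le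
    have e : J t = ∫ y in closedBall z t, u y * k t y := by
      refine setIntegral_eq_of_subset_of_forall_sdiff_eq_zero hBc.measurableSet htB ?_
      intro x hx
      have h1 := hx.2
      rw [mem_closedBall, dist_eq_norm, not_le] at h1
      simp only [hk]
      rw [prof_zero]
      · simp
      · rw [le_div_iff₀ (by positivity)]
        nlinarith
    have e2 : ⨍ y in closedBall z t, ‖u y‖ = (t ^ N * ω)⁻¹ * ∫ y in closedBall z t, ‖u y‖ := by
      rw [setAverage_eq, smul_eq_mul, Measure.addHaar_real_closedBall _ _ ht0.le]
      simp [hω]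
    have e3 : M * ω * ⨍ y in closedBall z t, ‖u y‖
        = ∫ y in closedBall z t, ‖u y‖ * ((t ^ N)⁻¹ * M) := by
      rw [e2, integral_mul_const]
      field_simp
    rw [e, e3]
    refine setIntegral_mono_on ((hint _ (kcont t)).mono_set htB)
      ((huB.mono_set htB).norm.mul_const _) measurableSet_closedBall ?_
    intro y hy
    rw [mem_closedBall, dist_eq_norm] at hy
    have hp : prof (‖y - z‖ ^ 2 / t ^ 2) ≤ M := by
      refine (le_abs_self _).trans (hM _ ⟨by positivity, ?_⟩)
      rw [div_le_one (by positivity)]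
      exact pow_le_pow_left₀ (norm_nonneg _) hy 2
    refine mul_le_mul (le_abs_self _) ?_ (k0 t ht0 y) (norm_nonneg _)
    exact mul_le_mul_of_nonneg_left hp (by positivity)
  have hJb : J b ≤ 0 := by
    have hlim : Tendsto (fun t => M * ω * ⨍ y in closedBall z t, ‖u y‖) (𝓝[>] (0 : ℝ)) (𝓝 0) := by
      simpa using havg.const_mul (M * ω)
    refine ge_of_tendsto hlim ?_
    filter_upwards [Ioo_mem_nhdsGT hb] with t ht
    exact (hanti ⟨ht.1, ht.2.trans hbR⟩ ⟨hb, hbR⟩ ht.2.le).trans (hle t ⟨ht.1, ht.2.trans hbR⟩)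
  have hnn : 0 ≤ᵐ[volume.restrict B] fun y => u y * k b y := by
    refine (ae_restrict_iff' hBc.measurableSet).2 ?_
    filter_upwards [hu0] with y hy hyB
    exact mul_nonneg (hy (hR hyB)) (k0 b hb y)
  have hJ0 : J b = 0 := le_antisymm hJb (integral_nonneg_of_ae hnn)
  have hz := (integral_eq_zero_iff_of_nonneg_ae hnn (hint _ (kcont b))).1 hJ0
  have hz' := (ae_restrict_iff' hBc.measurableSet).1 hz
  filter_upwards [hz'] with y hy hyb
  have hyB : y ∈ B := ball_subset_closedBall.trans (closedBall_subset_closedBall hbR.le) hyb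
  have h1 : u y * k b y = 0 := hy hyB
  have h2 : 0 < k b y := by
    refine mul_pos (by positivity) (prof_pos ?_)
    rw [mem_ball, dist_eq_norm] at hyb
    rw [div_lt_one (by positivity)]
    exact pow_lt_pow_left₀ hyb (norm_nonneg _) (by norm_num)
  rcases mul_eq_zero.1 h1 with h | h
  · exact h
  · exact absurd h h2.ne'

theorem ae_avg {N : ℕ} {Ω : Set (Euc N)} (hΩo : IsOpen Ω) {u : Euc N → ℝ}
    (huloc : LocallyIntegrableOn u Ω volume) :
    ∀ᵐ z ∂volume, z ∈ Ω → u z = 0 →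
      Tendsto (fun t => ⨍ y in closedBall z t, ‖u y‖) (𝓝[>] (0 : ℝ)) (𝓝 0) := by
  rw [ae_iff]
  refine measure_null_of_locally_null _ fun x hx => ?_
  simp only [Classical.not_imp, Set.mem_ofPred_eq] at hx
  obtain ⟨r, hr, hrΩ⟩ := nhds_basis_closedBall.mem_iff.1 (hΩo.mem_nhds hx.1)
  set B := closedBall x r with hB
  have hg : LocallyIntegrable (B.indicator u) volume := by
    apply Integrable.locallyIntegrable
    rw [integrable_indicator_iff measurableSet_closedBall]
    exact huloc.integrableOn_compact_subset hrΩ (isCompact_closedBall _ _)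
  have hL := IsUnifLocDoublingMeasure.ae_tendsto_average_norm_sub (μ := volume) hg 1
  refine ⟨_, inter_mem_nhdsWithin _ (ball_mem_nhds x hr), ?_⟩
  refine measure_mono_null ?_ (ae_iff.1 hL)
  rintro z ⟨hz, hzb⟩ hcon
  simp only [Classical.not_imp, Set.mem_ofPred_eq] at hz
  apply hz.2.2
  have h := hcon (l := 𝓝[>] (0 : ℝ)) (fun _ => z) id tendsto_id (by
    filter_upwards [self_mem_nhdsWithin] with t ht
    simpa using (le_of_lt ht : (0 : ℝ) ≤ t))
  refine h.congr' ?_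
  have hpos : 0 < r - dist z x := by rw [mem_ball] at hzb; linarith
  filter_upwards [Ioo_mem_nhdsGT hpos] with t ht
  rw [setAverage_eq, setAverage_eq]
  congr 1
  refine setIntegral_congr_fun measurableSet_closedBall fun y hy => ?_
  have hyB : y ∈ B := by
    rw [hB, mem_closedBall]
    simp only [id, mem_closedBall] at hy
    have := dist_triangle y z x
    linarith [ht.2]
  have hzB : z ∈ B := ball_subset_closedBall hzb
  simp [hyB, hzB, hz.2.1]

theorem u_pos {N : ℕ} {Ω : Set (Euc N)} (hΩo : IsOpen Ω) (hΩc : IsConnected Ω) {V u : Euc N → ℝ}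
    (hVpos : ∀ᵐ x ∂volume, x ∈ Ω → 0 < V x)
    (huloc : LocallyIntegrableOn u Ω volume)
    (hu0 : ∀ᵐ x ∂volume, x ∈ Ω → 0 ≤ u x)
    (hunt : ¬ (∀ᵐ x ∂volume, x ∈ Ω → u x = 0))
    (hsuper : ∀ φ : Euc N → ℝ, IsTestFun Ω φ → (∀ x, 0 ≤ φ x) →
      ∫ x in Ω, V x * u x * φ x ≤ ∫ x in Ω, u x * (-(lap φ x))) :
    ∀ᵐ x ∂volume, x ∈ Ω → 0 < u x := by
  have hP : ∀ᵐ z ∂volume, z ∈ Ω → u z = 0 → ∀ R, closedBall z R ⊆ Ω → ∀ b, 0 < b → b < R →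
      ∀ᵐ x ∂volume, x ∈ ball z b → u x = 0 := by
    filter_upwards [ae_avg hΩo huloc] with z hz hzΩ hz0 R hR b hb hbR
    exact zero_near hΩo hVpos huloc hu0 hsuper hR (hz hzΩ hz0) hb hbR
  set A : Set (Euc N) := {x | ∃ r > 0, ∀ᵐ y ∂volume, y ∈ ball x r → u y = 0} with hA
  have hAo : IsOpen A := by
    rw [Metric.isOpen_iff]
    rintro x ⟨r, hr, h⟩
    refine ⟨r / 2, by positivity, fun y hy => ⟨r / 2, by positivity, ?_⟩⟩
    filter_upwards [h] with w hw hwy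
    apply hw
    rw [mem_ball] at *
    linarith [dist_triangle w y x]
  have hcl : closure A ∩ Ω ⊆ A := by
    rintro x ⟨hxA, hxΩ⟩
    obtain ⟨d, hd, hdΩ⟩ := nhds_basis_closedBall.mem_iff.1 (hΩo.mem_nhds hxΩ)
    obtain ⟨y, ⟨r, hr, hy⟩, hxy⟩ := Metric.mem_closure_iff.1 hxA (d / 8) (by positivity)
    set s := min r (d / 8) with hs
    have hs0 : 0 < s := lt_min hr (by positivity)
    have hex : ∃ w ∈ ball y s, (u w = 0) ∧ (w ∈ Ω → u w = 0 → ∀ R, closedBall w R ⊆ Ω → ∀ b,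
        0 < b → b < R → ∀ᵐ x ∂volume, x ∈ ball w b → u x = 0) := by
      by_contra hno
      have : volume (ball y s) = 0 := by
        refine measure_mono_null ?_ (ae_iff.1 (hy.and hP))
        intro w hw hcon
        exact hno ⟨w, hw, hcon.1 (ball_subset_ball (min_le_left _ _) hw), hcon.2⟩
      exact (measure_ball_pos volume y hs0).ne' this
    obtain ⟨w, hw, hw0, hwP⟩ := hex
    have hwx : dist w x < d / 4 := by
      rw [mem_ball] at hw
      have := min_le_right r (d / 8)
      rw [dist_comm] at hxy
      linarith [dist_triangle w y x]
    have hsub : closedBall w (d / 2) ⊆ closedBall x d := by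
      intro v hv
      rw [mem_closedBall] at *
      linarith [dist_triangle v w x]
    have hwΩ : w ∈ Ω := hdΩ (hsub (mem_closedBall_self (by positivity)))
    have h := hwP hwΩ hw0 (d / 2) (hsub.trans hdΩ) (3 * d / 8) (by positivity) (by linarith)
    refine ⟨d / 8, by positivity, ?_⟩
    filter_upwards [h] with v hv hvx
    apply hv
    rw [mem_ball] at *
    rw [dist_comm] at hwx
    linarith [dist_triangle v x w]
  by_cases hne : (Ω ∩ A).Nonempty
  · exfalso
    have hsub := hΩc.isPreconnected.subset_of_closure_inter_subset hAo hne hcl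
    apply hunt
    rw [ae_iff]
    refine measure_null_of_locally_null _ fun x hx => ?_
    simp only [Classical.not_imp, Set.mem_ofPred_eq] at hx
    obtain ⟨r, hr, h⟩ := hsub hx.1
    refine ⟨_, inter_mem_nhdsWithin _ (ball_mem_nhds x hr), ?_⟩
    refine measure_mono_null ?_ (ae_iff.1 h)
    rintro z ⟨hz, hzb⟩ hcon
    simp only [Classical.not_imp, Set.mem_ofPred_eq] at hz
    exact hz.2 (hcon hzb)
  · filter_upwards [hP, hu0] with x hx hx0 hxΩ
    refine lt_of_le_of_ne (hx0 hxΩ) fun h0 => hne ⟨x, hxΩ, ?_⟩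
    obtain ⟨d, hd, hdΩ⟩ := nhds_basis_closedBall.mem_iff.1 (hΩo.mem_nhds hxΩ)
    exact ⟨d / 2, by positivity, hx hxΩ h0.symm d hdΩ (d / 2) (by positivity) (by linarith)⟩

/-- **Lemma 1.4 (Allegretto–Piepenbrink).** If `V ∈ L¹_loc(Ω)`, `V > 0` a.e., and there is
a nonnegative nontrivial `u ∈ L¹_loc(Ω)` with `Vu ∈ L¹_loc(Ω)` and `-Δu ≥ Vu` in `D'(Ω)`,
then `∫ |∇φ|² ≥ ∫ V φ²` for every `φ ∈ C_c^∞(Ω)`. -/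
theorem allegretto_piepenbrink {N : ℕ} (hN : 1 ≤ N) (Ω : Set (Euc N))
    (hΩo : IsOpen Ω) (hΩc : IsConnected Ω)
    (V u : Euc N → ℝ)
    (hVloc : LocallyIntegrableOn V Ω volume)
    (hVpos : ∀ᵐ x ∂volume, x ∈ Ω → 0 < V x)
    (huloc : LocallyIntegrableOn u Ω volume)
    (hVu : LocallyIntegrableOn (fun x => V x * u x) Ω volume)
    (hu0 : ∀ᵐ x ∂volume, x ∈ Ω → 0 ≤ u x)
    (hunt : ¬ (∀ᵐ x ∂volume, x ∈ Ω → u x = 0))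
    (hsuper : ∀ φ : Euc N → ℝ, IsTestFun Ω φ → (∀ x, 0 ≤ φ x) →
      ∫ x in Ω, V x * u x * φ x ≤ ∫ x in Ω, u x * (-(lap φ x))) :
    ∀ φ : Euc N → ℝ, IsTestFun Ω φ →
      ∫ x in Ω, V x * φ x ^ 2 ≤ ∫ x in Ω, ‖gradient φ x‖ ^ 2 := by
  intro φ hφ
  obtain ⟨hφs, hφc, hφΩ⟩ := hφ
  have hupos := u_pos hΩo hΩc hVpos huloc hu0 hunt hsuper
  obtain ⟨L, hL, hKL, hLΩ⟩ := exists_compact_between hφc hΩo hφΩ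
  obtain ⟨ε, hε, hεL⟩ := hφc.isCompact.exists_cthickening_subset_open isOpen_interior hKL
  have hball : ∀ x ∈ tsupport φ, closedBall x ε ⊆ L := fun x hx =>
    (closedBall_subset_cthickening hx ε).trans (hεL.trans interior_subset)
  set E := ∫ x, ‖gradient φ x‖ ^ 2 with hE
  have hEΩ : ∫ x in Ω, ‖gradient φ x‖ ^ 2 = E := by
    refine setIntegral_eq_integral_of_forall_compl_eq_zero fun x hx => ?_
    have : fderiv ℝ φ x = 0 := fderiv_of_notMem_tsupport (𝕜 := ℝ) fun h => hx (hφΩ h)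
    simp [gradient, this]
  rw [hEΩ]
  let bmp : ℕ → ContDiffBump (0 : Euc N) := fun n =>
    { rIn := ε / (2 * (n + 1)), rOut := ε / (n + 1), rIn_pos := by positivity
      rIn_lt_rOut := by
        apply div_lt_div_of_pos_left hε (by positivity)
        have : (0 : ℝ) ≤ n := Nat.cast_nonneg n
        linarith }
  have hr0 : Tendsto (fun n => (bmp n).rOut) atTop (𝓝 0) := by
    have := (tendsto_one_div_add_atTop_nhds_zero_nat (𝕜 := ℝ)).const_mul ε
    simpa [bmp, div_eq_mul_inv] using this
  have hr1 : ∀ᶠ n in atTop, (bmp n).rOut ≤ 2 * (bmp n).rIn := by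
    refine Eventually.of_forall fun n => ?_
    simp only [bmp]
    apply le_of_eq
    field_simp
  have hrε : ∀ n, (bmp n).rOut ≤ ε := fun n => by
    simp only [bmp]
    apply div_le_self hε.le
    have : (0 : ℝ) ≤ n := Nat.cast_nonneg n
    linarith
  set η : ℕ → Euc N → ℝ := fun n => (bmp n).normed volume with hη
  have ηs : ∀ n, ContDiff ℝ (⊤ : ℕ∞) (η n) := fun n => (bmp n).contDiff_normed
  have η0 : ∀ n x, 0 ≤ η n x := fun n x => (bmp n).nonneg_normed x
  have ηc : ∀ n, HasCompactSupport (η n) := fun n => (bmp n).hasCompactSupport_normed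
  have ηt : ∀ n, tsupport (η n) ⊆ closedBall 0 ε := fun n => by
    simp only [hη]
    rw [(bmp n).tsupport_normed_eq]
    exact closedBall_subset_closedBall (hrε n)
  have hloc : ∀ f : Euc N → ℝ, LocallyIntegrableOn f Ω volume →
      LocallyIntegrable (L.indicator f) volume := by
    intro f hf
    apply Integrable.locallyIntegrable
    rw [integrable_indicator_iff hL.measurableSet]
    exact hf.integrableOn_compact_subset hLΩ hL
  have hg := hloc u huloc
  have hh := hloc _ hVu
  set w : ℕ → Euc N → ℝ := fun n x => ∫ y, L.indicator u y * η n (x - y) with hw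
  set h : ℕ → Euc N → ℝ := fun n x => ∫ y, L.indicator (fun y => V y * u y) y * η n (x - y) with hh'
  have ws : ∀ n, ContDiff ℝ (⊤ : ℕ∞) (w n) := fun n => moll_smooth hg (ηs n) (ηc n)
  have hs : ∀ n, ContDiff ℝ (⊤ : ℕ∞) (h n) := fun n => moll_smooth hh (ηs n) (ηc n)
  have w0 : ∀ n x, 0 ≤ w n x := fun n x => by
    apply integral_nonneg_of_ae
    filter_upwards [hu0] with y hy
    refine mul_nonneg ?_ (η0 n _)
    exact Set.indicator_apply_nonneg fun hyL => hy (hLΩ hyL)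
  have h0 : ∀ n x, 0 ≤ h n x := fun n x => by
    apply integral_nonneg_of_ae
    filter_upwards [hu0, hVpos] with y hy hy'
    refine mul_nonneg ?_ (η0 n _)
    exact Set.indicator_apply_nonneg fun hyL => mul_nonneg (hy' (hLΩ hyL)).le (hy (hLΩ hyL))
  have hconv : ∀ f : Euc N → ℝ, LocallyIntegrable f volume → ∀ᵐ x ∂volume,
      Tendsto (fun n => ∫ y, f y * η n (x - y)) atTop (𝓝 (f x)) := by
    intro f hf
    filter_upwards [ContDiffBump.ae_convolution_tendsto_right_of_locallyIntegrable
      (μ := volume) hr0 hr1 hf] with x hx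
    refine hx.congr fun n => ?_
    rw [convolution_lsmul_swap]
    simp only [smul_eq_mul, mul_comm, hη]
  set F : ℕ → Euc N → ℝ := fun n x => h n x * (φ x ^ 2 / (w n x + 1 / ((n : ℝ) + 1))) with hF
  have hδ : ∀ n : ℕ, (0 : ℝ) < 1 / ((n : ℝ) + 1) := fun n => by positivity
  have hden : ∀ n x, 0 < w n x + 1 / ((n : ℝ) + 1) := fun n x => by linarith [w0 n x, hδ n]
  have F0 : ∀ n x, 0 ≤ F n x := fun n x =>
    mul_nonneg (h0 n x) (div_nonneg (sq_nonneg _) (hden n x).le)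
  have Fc : ∀ n, Continuous (F n) := fun n =>
    (hs n).continuous.mul ((hφs.continuous.pow 2).div ((ws n).continuous.add continuous_const)
      fun x => (hden n x).ne')
  have Fle : ∀ n x, F n x ≤ (-(lap (w n) x)) * (φ x ^ 2 / (w n x + 1 / ((n : ℝ) + 1))) := by
    intro n x
    by_cases hx : x ∈ tsupport φ
    · refine mul_le_mul_of_nonneg_right ?_ (div_nonneg (sq_nonneg _) (hden n x).le)
      exact moll_super hL hLΩ hΩo huloc hsuper (ηs n) (η0 n) (ηt n) (hball x hx)
    · have : φ x = 0 := image_eq_zero_of_notMem_tsupport hx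
      simp [hF, this]
  have Fint : ∀ n, ∫⁻ x, ENNReal.ofReal (F n x) ≤ ENNReal.ofReal E := by
    intro n
    obtain ⟨p1, p2⟩ := picone (ws n) (w0 n) hφs hφc (hδ n)
    calc ∫⁻ x, ENNReal.ofReal (F n x)
        ≤ ∫⁻ x, ENNReal.ofReal ((-(lap (w n) x)) * (φ x ^ 2 / (w n x + 1 / ((n : ℝ) + 1)))) :=
          lintegral_mono fun x => ENNReal.ofReal_le_ofReal (Fle n x)
      _ = ENNReal.ofReal (∫ x, (-(lap (w n) x)) * (φ x ^ 2 / (w n x + 1 / ((n : ℝ) + 1)))) :=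
          (ofReal_integral_eq_lintegral_ofReal p1
            (Eventually.of_forall fun x => (F0 n x).trans (Fle n x))).symm
      _ ≤ ENNReal.ofReal E := ENNReal.ofReal_le_ofReal p2
  have fatou : ∫⁻ x, liminf (fun n => ENNReal.ofReal (F n x)) atTop ≤ ENNReal.ofReal E := by
    refine (lintegral_liminf_le fun n => (Fc n).measurable.ennreal_ofReal).trans ?_
    calc liminf (fun n => ∫⁻ x, ENNReal.ofReal (F n x)) atTop
        ≤ liminf (fun _ : ℕ => ENNReal.ofReal E) atTop :=
          liminf_le_liminf (Eventually.of_forall Fint)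
      _ = ENNReal.ofReal E := liminf_const _
  have hlim : ∀ᵐ x ∂volume, x ∈ Ω → ENNReal.ofReal (V x * φ x ^ 2)
      = liminf (fun n => ENNReal.ofReal (F n x)) atTop := by
    filter_upwards [hconv _ hg, hconv _ hh, hupos] with x h1 h2 h3 hxΩ
    refine (Tendsto.liminf_eq ?_).symm
    refine ENNReal.tendsto_ofReal ?_
    by_cases hx : x ∈ L
    · have hux := h3 hxΩ
      simp only [Set.indicator_of_mem hx] at h1 h2
      have h4 : Tendsto (fun n : ℕ => w n x + 1 / ((n : ℝ) + 1)) atTop (𝓝 (u x + 0)) :=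
        h1.add tendsto_one_div_add_atTop_nhds_zero_nat
      rw [add_zero] at h4
      have h5 := h2.mul ((tendsto_const_nhds (x := φ x ^ 2)).div h4 hux.ne')
      have e : V x * u x * (φ x ^ 2 / u x) = V x * φ x ^ 2 := by
        field_simp
      rw [e] at h5
      exact h5
    · have : φ x = 0 := image_eq_zero_of_notMem_tsupport fun h => hx (interior_subset (hKL h))
      simp [hF, this]
  have hfin : ∫⁻ x in Ω, ENNReal.ofReal (V x * φ x ^ 2) ≤ ENNReal.ofReal E := by
    rw [lintegral_congr_ae ((ae_restrict_iff' hΩo.measurableSet).2 hlim)]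
    exact (setLIntegral_le_lintegral _ _).trans fatou
  have hE0 : 0 ≤ E := integral_nonneg fun x => sq_nonneg _
  rw [integral_eq_lintegral_of_nonneg_ae]
  · exact ENNReal.toReal_le_of_le_ofReal hE0 hfin
  · refine (ae_restrict_iff' hΩo.measurableSet).2 ?_
    filter_upwards [hVpos] with x hx hxΩ
    exact mul_nonneg (hx hxΩ).le (sq_nonneg _)
  · exact hVloc.aestronglyMeasurable.mul (hφs.continuous.pow 2).aestronglyMeasurable
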